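/- Let A be a finite-dimensional algebra with id_A A ≤ 1, C = Sub A the category of submodules of finite free A-modules, and M a cluster tilting object in C. Then for every X in C there is a short exact sequence 0 → X → M₀ → M₁ → 0 with M₀, M₁ ∈ add M, and consequently the Γ = End_A(M)-module Hom_A(X, M) has projective dimension at most 1. -/

import Mathlib

/-!
STATEMENT 7. Let A be a finite-dimensional algebra with id_A A ≤ 1, C = Sub A the
category of submodules of finite free A-modules, and M a cluster tilting object in C.
Then for every X in C there is a short exact sequence 0 → X → M₀ → M₁ → 0 with
M₀, M₁ ∈ add M, and consequently the Γ = End_A(M)-module Hom_A(X, M) has projective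
dimension at most 1.
-/

/-- `Ext¹_A(Z, X) = 0`: every short exact sequence `0 → X → E → Z → 0` splits. -/
def Ext1Zero (A : Type) [Ring A] (Z X : Type) [AddCommGroup Z] [Module A Z]
    [AddCommGroup X] [Module A X] : Prop :=
  ∀ (E : Type) [AddCommGroup E] [Module A E] (f : X →ₗ[A] E) (g : E →ₗ[A] Z),
    Function.Injective f → Function.Surjective g → LinearMap.range f = LinearMap.ker g →
    ∃ s : Z →ₗ[A] E, g ∘ₗ s = LinearMap.id

/-- `X ∈ Sub A` : `X` embeds into a finite free `A`-module. -/
def InSub (A : Type) [Ring A] (X : Type) [AddCommGroup X] [Module A X] : Prop :=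
  ∃ (n : ℕ) (f : X →ₗ[A] (Fin n → A)), Function.Injective f

/-- `X ∈ add M` : `X` is a direct summand of a finite direct sum of copies of `M`. -/
def InAdd (A : Type) [Ring A] (M X : Type) [AddCommGroup M] [Module A M]
    [AddCommGroup X] [Module A X] : Prop :=
  ∃ (n : ℕ) (s : X →ₗ[A] (Fin n → M)) (r : (Fin n → M) →ₗ[A] X), r ∘ₗ s = LinearMap.id

/-- `M` is a cluster tilting object of `Sub A`. -/
def IsClusterTilting (A : Type) [Ring A] (M : Type) [AddCommGroup M] [Module A M] : Prop :=
  InSub A M ∧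
  ∀ (X : Type) [AddCommGroup X] [Module A X], InSub A X →
    ((Ext1Zero A M X ↔ InAdd A M X) ∧ (Ext1Zero A X M ↔ InAdd A M X))

/-- `id_A A ≤ 1` : there is an exact sequence `0 → A → I₀ → I₁ → 0` with `I₀, I₁` injective. -/
def InjDimLE1 (A : Type) [Ring A] : Prop :=
  ∃ (I₀ : ModuleCat.{0} A) (ι : A →ₗ[A] I₀), Module.Injective A I₀ ∧
    Function.Injective ι ∧ Module.Injective A (I₀ ⧸ LinearMap.range ι)

/-- projective dimension at most `n` (via iterated syzygies). -/
def pdLE (R : Type) [Ring R] : ℕ → ModuleCat.{0} R → Prop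
  | 0, D => Module.Projective R D
  | n + 1, D => ∃ (P : ModuleCat.{0} R) (p : P →ₗ[R] D), Module.Projective R P ∧
      Function.Surjective p ∧ pdLE R n (ModuleCat.of R (LinearMap.ker p))


open Function TensorProduct

/-- Finite-dimensional modules over a `k`-algebra `R`. -/
structure FDMod (k R : Type) [Field k] [Ring R] [Algebra k R] : Type 1 where
  carrier : Type
  [addCommGroup : AddCommGroup carrier]
  [moduleField : Module k carrier]
  [module : Module R carrier]
  [isScalarTower : IsScalarTower k R carrier]
  [finite : Module.Finite k carrier]

namespace FDMod

attribute [instance] addCommGroup moduleField module isScalarTower finite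

instance (k R : Type) [Field k] [Ring R] [Algebra k R] : CoeSort (FDMod k R) Type :=
  ⟨carrier⟩

section Additive

variable (k R : Type) [Field k] [Ring R] [Algebra k R]

/-- The bundled version of a finite-dimensional module. -/
abbrev of (X : Type) [AddCommGroup X] [Module k X] [Module R X] [IsScalarTower k R X]
    [Module.Finite k X] : FDMod k R := ⟨X⟩

/-- The rational vector space of functions additive on short exact sequences. -/
def additive : Submodule ℚ (FDMod k R → ℚ) where
  carrier := {l | ∀ (X Y Z : FDMod k R) (f : X →ₗ[R] Y) (g : Y →ₗ[R] Z),
    Injective f → Surjective g → LinearMap.range f = LinearMap.ker g → l Y = l X + l Z}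
  add_mem' {a b} ha hb X Y Z f g h₁ h₂ h₃ := by
    simp only [Pi.add_apply, ha X Y Z f g h₁ h₂ h₃, hb X Y Z f g h₁ h₂ h₃]; ring
  zero_mem' X Y Z f g _ _ _ := by simp
  smul_mem' c l hl X Y Z f g h₁ h₂ h₃ := by
    simp only [Pi.smul_apply, hl X Y Z f g h₁ h₂ h₃, smul_add]

variable {k R}

theorem additive_subsingleton {l : FDMod k R → ℚ} (hl : l ∈ additive k R) (X : FDMod k R)
    [Subsingleton X] : l X = 0 := by
  have := hl X X X LinearMap.id LinearMap.id injective_id surjective_id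
    (Submodule.ext fun x => by simp [Subsingleton.elim x 0])
  linarith

theorem additive_congr {l : FDMod k R → ℚ} (hl : l ∈ additive k R) {X Y : FDMod k R}
    (f : X →ₗ[R] Y) (hf : Bijective f) : l X = l Y := by
  have := hl X Y (of k R PUnit) f 0 hf.1 (fun _ => ⟨0, Subsingleton.elim _ _⟩)
    (by rw [LinearMap.range_eq_top.2 hf.2, LinearMap.ker_zero])
  rw [this, additive_subsingleton hl (of k R PUnit), add_zero]

theorem finrank_mem_additive :
    (fun X : FDMod k R => (Module.finrank k X : ℚ)) ∈ additive k R := by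
  intro X Y Z f g hf hg h
  have h₁ := LinearMap.finrank_range_add_finrank_ker (g.restrictScalars k)
  rw [LinearMap.range_eq_top.2 (show Surjective (g.restrictScalars k) from hg), finrank_top,
    LinearMap.ker_restrictScalars, ← h] at h₁
  have h₂ := LinearMap.finrank_range_of_inj (f := f.restrictScalars k) hf
  rw [LinearMap.range_restrictScalars] at h₂
  have h₃ := h₂ ▸ h₁
  simp only
  rw [← h₃]; push_cast; ring

instance submoduleFinite {V : Type} [AddCommGroup V] [Module k V] [Module R V]
    [IsScalarTower k R V] [Module.Finite k V] (S : Submodule R V) : Module.Finite k S :=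
  inferInstanceAs (Module.Finite k (S.restrictScalars k))

instance quotientFinite {V : Type} [AddCommGroup V] [Module k V] [Module R V]
    [IsScalarTower k R V] [Module.Finite k V] (S : Submodule R V) : Module.Finite k (V ⧸ S) :=
  Module.Finite.of_surjective (S.mkQ.restrictScalars k) S.mkQ_surjective

instance isArtinian (Y : FDMod k R) : IsArtinian R Y := isArtinian_of_tower k inferInstance

theorem additive_quotient {l : FDMod k R → ℚ} (hl : l ∈ additive k R) (X : FDMod k R)
    (S : Submodule R X) : l X = l (of k R S) + l (of k R (X ⧸ S)) :=
  hl (of k R S) X (of k R (X ⧸ S)) S.subtype S.mkQ S.subtype_injective S.mkQ_surjective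
    (by simp)

theorem exists_isSimpleModule (X : FDMod k R) [Nontrivial X] :
    ∃ S : Submodule R X, IsSimpleModule R S := by
  obtain ⟨S, hS, -⟩ := (eq_bot_or_exists_atom_le (⊤ : Submodule R X)).resolve_left top_ne_bot
  exact ⟨S, isSimpleModule_iff_isAtom.2 hS⟩

theorem finrank_quotient_lt (X : FDMod k R) (S : Submodule R X) [IsSimpleModule R S] :
    Module.finrank k (X ⧸ S) < Module.finrank k X := by
  have h := finrank_mem_additive (of k R S) X (of k R (X ⧸ S)) S.subtype S.mkQ
    S.subtype_injective S.mkQ_surjective (by simp)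
  simp only at h
  have : Nontrivial S := IsSimpleModule.nontrivial R S
  have h₂ : 0 < Module.finrank k S := Module.finrank_pos
  have h₃ : Module.finrank k X = Module.finrank k S + Module.finrank k (X ⧸ S) := by
    exact_mod_cast h
  omega

/-- Only finitely many simple modules receive a nonzero map from a given module. -/
theorem exists_finite_simple_targets (n : ℕ) (Y : FDMod k R) (hn : Module.finrank k Y ≤ n) :
    ∃ s : Set (FDMod k R), s.Finite ∧ ∀ (S : FDMod k R) [IsSimpleModule R S] (f : Y →ₗ[R] S),
      f ≠ 0 → ∃ C ∈ s, ∃ e : C →ₗ[R] S, Bijective e := by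
  induction n generalizing Y with
  | zero =>
    have : Subsingleton Y := Module.finrank_zero_iff.1 (Nat.le_zero.1 hn)
    exact ⟨∅, Set.finite_empty, fun S _ f hf =>
      (hf (LinearMap.ext fun y => by simp [Subsingleton.elim y 0])).elim⟩
  | succ n ih =>
    rcases subsingleton_or_nontrivial Y with hY | hY
    · exact ⟨∅, Set.finite_empty, fun S _ f hf =>
        (hf (LinearMap.ext fun y => by simp [Subsingleton.elim y 0])).elim⟩
    obtain ⟨Y₀, hY₀⟩ := exists_isSimpleModule Y
    have hlt := finrank_quotient_lt Y Y₀
    obtain ⟨s, hs, h⟩ := ih (of k R (Y ⧸ Y₀)) (by simp only; omega)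
    refine ⟨insert (of k R Y₀) s, hs.insert _, fun S _ f hf => ?_⟩
    by_cases h₀ : f ∘ₗ Y₀.subtype = 0
    · obtain ⟨C, hC, e⟩ := h S (Y₀.liftQ f fun y hy => LinearMap.congr_fun h₀ ⟨y, hy⟩)
        fun h₁ => hf (by rw [← Y₀.liftQ_mkQ f (fun y hy => LinearMap.congr_fun h₀ ⟨y, hy⟩), h₁,
          LinearMap.zero_comp])
      exact ⟨C, Set.mem_insert_of_mem _ hC, e⟩
    · exact ⟨_, Set.mem_insert _ _, f ∘ₗ Y₀.subtype, LinearMap.bijective_of_ne_zero h₀⟩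

theorem additive_eq_zero {l : FDMod k R → ℚ} (hl : l ∈ additive k R)
    (h : ∀ (S : FDMod k R) [IsSimpleModule R S], l S = 0) (n : ℕ) (X : FDMod k R)
    (hn : Module.finrank k X ≤ n) : l X = 0 := by
  induction n generalizing X with
  | zero =>
    have : Subsingleton X := Module.finrank_zero_iff.1 (Nat.le_zero.1 hn)
    exact additive_subsingleton hl X
  | succ n ih =>
    rcases subsingleton_or_nontrivial X with hX | hX
    · exact additive_subsingleton hl X
    obtain ⟨S, hS⟩ := exists_isSimpleModule X
    have hlt := finrank_quotient_lt X S
    have : IsSimpleModule R (of k R S) := hS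
    rw [additive_quotient hl X S, h (of k R S), ih (of k R (X ⧸ S)) (by simp only; omega),
      add_zero]

instance additive_finiteDimensional [Module.Finite k R] :
    FiniteDimensional ℚ (additive k R) := by
  obtain ⟨s, hs, h⟩ := exists_finite_simple_targets _ (of k R R) le_rfl
  have : Finite s := hs
  let ev : additive k R →ₗ[ℚ] (s → ℚ) :=
    (LinearMap.funLeft ℚ ℚ (Subtype.val : s → FDMod k R)) ∘ₗ (additive k R).subtype
  refine Module.Finite.of_injective ev ((injective_iff_map_eq_zero ev).2 fun l hl => ?_)
  ext X
  refine additive_eq_zero l.2 (fun S _ => ?_) _ X le_rfl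
  have : Nontrivial S := IsSimpleModule.nontrivial R S
  obtain ⟨x, hx⟩ := exists_ne (0 : S)
  obtain ⟨C, hC, e, he⟩ := h S (LinearMap.toSpanSingleton R S x)
    fun h₀ => hx (by simpa using LinearMap.congr_fun h₀ (1 : R))
  rw [← additive_congr l.2 e he]
  exact congr_fun hl ⟨C, hC⟩

end Additive

section Dual

variable {k R S : Type} [Field k] [Ring R] [Algebra k R] [Ring S] [Algebra k S]

/-- The `k`-dual of a module over `R`, as a module over `S ≃ Rᵐᵒᵖ`. -/
def Dual (_ : S ≃ₐ[k] Rᵐᵒᵖ) (X : FDMod k R) : Type := X →ₗ[k] k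

variable (e : S ≃ₐ[k] Rᵐᵒᵖ) (X : FDMod k R)

instance : AddCommGroup (Dual e X) := inferInstanceAs (AddCommGroup (X →ₗ[k] k))
instance : Module k (Dual e X) := inferInstanceAs (Module k (X →ₗ[k] k))
instance : Module.Finite k (Dual e X) := inferInstanceAs (Module.Finite k (X →ₗ[k] k))
instance : FunLike (Dual e X) X k := inferInstanceAs (FunLike (X →ₗ[k] k) X k)
instance : LinearMapClass (Dual e X) k X k :=
  inferInstanceAs (LinearMapClass (X →ₗ[k] k) k X k)

theorem Dual.ext {f g : Dual e X} (h : ∀ x, f x = g x) : f = g := LinearMap.ext h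

instance : Module S (Dual e X) where
  smul s f := (show X →ₗ[k] k from f) ∘ₗ Algebra.lsmul k k X (e s).unop
  one_smul f := Dual.ext e X fun x => show f ((e 1).unop • x) = f x by simp
  mul_smul s t f := Dual.ext e X fun x =>
    show f ((e (s * t)).unop • x) = f ((e t).unop • (e s).unop • x) by simp [mul_smul]
  smul_zero s := rfl
  smul_add s f g := rfl
  add_smul s t f := Dual.ext e X fun x =>
    show f ((e (s + t)).unop • x) = f ((e s).unop • x) + f ((e t).unop • x) by
      simp [add_smul]
  zero_smul f := Dual.ext e X fun x => show f ((e 0).unop • x) = 0 by simp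

instance : IsScalarTower k S (Dual e X) where
  smul_assoc c s f := Dual.ext e X fun x =>
    show f ((e (c • s)).unop • x) = c • f ((e s).unop • x) by simp

variable {X} in
/-- The transpose of a linear map. -/
def Dual.map {Y : FDMod k R} (f : X →ₗ[R] Y) : Dual e Y →ₗ[S] Dual e X where
  toFun g := (show Y →ₗ[k] k from g) ∘ₗ f.restrictScalars k
  map_add' _ _ := rfl
  map_smul' s g := Dual.ext e X fun x =>
    show g ((e s).unop • f x) = g (f ((e s).unop • x)) by simp

/-- Precomposition of additive functions with the `k`-dual. -/
def dualAdditive : additive k S →ₗ[ℚ] additive k R where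
  toFun l := ⟨fun X => l.1 (of k S (Dual e X)), fun X Y Z f g hf hg h => by
    rw [add_comm]
    refine l.2 (of k S (Dual e Z)) (of k S (Dual e Y)) (of k S (Dual e X)) (Dual.map e g)
      (Dual.map e f) ?_ ?_ ?_
    · intro a b hab
      refine Dual.ext e Z fun z => ?_
      obtain ⟨y, rfl⟩ := hg z
      exact LinearMap.congr_fun hab y
    · intro a
      obtain ⟨r, hr⟩ := (f.restrictScalars k).exists_leftInverse_of_injective
        (LinearMap.ker_eq_bot.2 hf)
      refine ⟨(show X →ₗ[k] k from a) ∘ₗ r, ?_⟩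
      exact (LinearMap.comp_assoc _ _ _).trans ((congr_arg _ hr).trans (LinearMap.comp_id _))
    · have h' : ∀ x, g (f x) = 0 := fun x => by
        have : f x ∈ LinearMap.ker g := h ▸ LinearMap.mem_range_self f x
        exact this
      ext a
      constructor
      · rintro ⟨b, rfl⟩
        refine Dual.ext e X fun x => ?_
        show (show Dual e Z from b) (g (f x)) = 0
        rw [h' x, map_zero]
      · intro ha
        obtain ⟨r, hr⟩ := (g.restrictScalars k).exists_rightInverse_of_surjective
          (LinearMap.range_eq_top.2 hg)
        refine ⟨(show Y →ₗ[k] k from a) ∘ₗ r, ?_⟩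
        refine Dual.ext e Y fun y => ?_
        change Dual e Y at a
        show a (r (g y)) = a y
        have hy : r (g y) - y ∈ LinearMap.ker g := by
          have := LinearMap.congr_fun hr (g y)
          simpa [sub_eq_zero] using this
        rw [← h] at hy
        obtain ⟨x, hx⟩ := hy
        have : a (f x) = 0 := LinearMap.congr_fun ha x
        rw [hx, map_sub, sub_eq_zero] at this
        exact this⟩
  map_add' _ _ := rfl
  map_smul' _ _ := rfl

theorem dualAdditive_injective : Injective (dualAdditive e) := by
  refine (injective_iff_map_eq_zero _).2 fun l hl => ?_
  ext X
  let e' : R ≃ₐ[k] Sᵐᵒᵖ := (AlgEquiv.opOp k R).trans e.symm.op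
  have h : l.1 (of k S (Dual e (of k R (Dual e' X)))) = 0 :=
    congr_fun (congr_arg Subtype.val hl) (of k R (Dual e' X))
  let f : X →ₗ[S] of k S (Dual e (of k R (Dual e' X))) :=
    { toFun := fun x => Module.Dual.eval k X x
      map_add' := fun x y => map_add (Module.Dual.eval k X) x y
      map_smul' := fun s x => Dual.ext e (of k R (Dual e' X)) fun (g : Dual e' X) => by
        show g (s • x) = g ((e' (e s).unop).unop • x)
        simp [e'] }
  have hf : Bijective f := Module.bijective_dual_eval k X
  exact (additive_congr l.2 f hf).trans h

end Dual

end FDMod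

section Sub

variable {A : Type} [Ring A] {X Y Z : Type} [AddCommGroup X] [Module A X] [AddCommGroup Y]
  [Module A Y] [AddCommGroup Z] [Module A Z]

theorem InSub.of_injective (hY : InSub A Y) (f : X →ₗ[A] Y) (hf : Injective f) : InSub A X := by
  obtain ⟨n, g, hg⟩ := hY
  exact ⟨n, g ∘ₗ f, hg.comp hf⟩

theorem InSub.pi (hY : InSub A Y) (m : ℕ) : InSub A (Fin m → Y) := by
  obtain ⟨n, g, hg⟩ := hY
  let e := (LinearEquiv.curry A A (Fin m) (Fin n)).symm.trans
    (LinearEquiv.funCongrLeft A A (finProdFinEquiv (m := m) (n := n))).symm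
  exact ⟨m * n, e.toLinearMap ∘ₗ LinearMap.pi fun i => g ∘ₗ LinearMap.proj i,
    e.injective.comp fun x y h => funext fun i => hg (congr_fun h i)⟩

/-- If `A` has injective dimension at most one and the cokernel of `f` is torsionless, then every
map to `A` extends along `f`. -/
theorem InjDimLE1.exists_extension (hid : InjDimLE1 A) (hZ : InSub A Z) (f : X →ₗ[A] Y)
    (g : Y →ₗ[A] Z) (hf : Injective f) (h : LinearMap.range f = LinearMap.ker g)
    (u : X →ₗ[A] A) : ∃ v : Y →ₗ[A] A, v ∘ₗ f = u := by
  obtain ⟨I, ι, hI, hι, hJ⟩ := hid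
  obtain ⟨n, j, hj⟩ := hZ
  obtain ⟨u', hu'⟩ := hI.out f hf (ι ∘ₗ u)
  let q := (LinearMap.range ι).mkQ
  have hker : LinearMap.ker g ≤ LinearMap.ker (q ∘ₗ u') := by
    rw [← h]
    rintro _ ⟨x, rfl⟩
    simp [q, hu']
  have hinj : Injective ((LinearMap.ker g).liftQ (j ∘ₗ g) fun y hy => by
      simp [LinearMap.mem_ker.1 hy]) := by
    rw [← LinearMap.ker_eq_bot, Submodule.ker_liftQ_eq_bot]
    exact fun y hy => hj (by simpa using hy)
  obtain ⟨w, hw⟩ := hJ.out _ hinj ((LinearMap.ker g).liftQ (q ∘ₗ u') hker)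
  obtain ⟨w', hw'⟩ := Module.projective_lifting_property q w (Submodule.mkQ_surjective _)
  have hmem : ∀ y, (u' - w' ∘ₗ j ∘ₗ g) y ∈ LinearMap.range ι := fun y => by
    have h₁ : w (j (g y)) = q (u' y) := hw (Submodule.Quotient.mk y)
    have h₂ : q (w' (j (g y))) = w (j (g y)) := LinearMap.congr_fun hw' _
    rw [← Submodule.ker_mkQ (LinearMap.range ι), LinearMap.mem_ker]
    simp only [LinearMap.sub_apply, LinearMap.comp_apply, map_sub]
    exact sub_eq_zero.2 (h₁.symm.trans h₂.symm)
  let e := LinearEquiv.ofInjective ι hι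
  refine ⟨e.symm.toLinearMap ∘ₗ (u' - w' ∘ₗ j ∘ₗ g).codRestrict _ hmem, LinearMap.ext fun x => ?_⟩
  have hg : g (f x) = 0 := by
    have : f x ∈ LinearMap.ker g := h ▸ LinearMap.mem_range_self f x
    exact this
  refine e.injective (Subtype.ext ?_)
  simp [e, hu', hg]

/-- The dual of a finitely generated right module is torsionless. -/
theorem inSub_dual_of_surjective {N : Type} [AddCommGroup N] [Module Aᵐᵒᵖ N] {n : ℕ}
    (p : (Fin n → A) →ₗ[Aᵐᵒᵖ] N) (hp : Surjective p) : InSub A (N →ₗ[Aᵐᵒᵖ] A) := by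
  refine ⟨n, LinearMap.pi fun i =>
    { toFun := fun f => f (p (Pi.single i 1)), map_add' := fun _ _ => rfl,
      map_smul' := fun _ _ => rfl }, fun f g hfg => LinearMap.ext fun x => ?_⟩
  obtain ⟨a, rfl⟩ := hp x
  have ha : a = ∑ i, MulOpposite.op (a i) • (Pi.single i 1 : Fin n → A) := by
    ext j
    simp [Finset.sum_apply, Pi.single_apply]
  have hfg' : ∀ i, f (p (Pi.single i 1)) = g (p (Pi.single i 1)) := congr_fun hfg
  rw [ha]
  simp [hfg']

end Sub

theorem exists_free_surjective (A N : Type) [Ring A] [AddCommGroup N] [Module Aᵐᵒᵖ N]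
    [Module.Finite Aᵐᵒᵖ N] : ∃ (n : ℕ) (p : (Fin n → A) →ₗ[Aᵐᵒᵖ] N), Surjective p := by
  obtain ⟨n, p, hp⟩ := Module.Finite.exists_fin' Aᵐᵒᵖ N
  let e : (Fin n → A) →ₗ[Aᵐᵒᵖ] (Fin n → Aᵐᵒᵖ) :=
    { toFun := fun a i => MulOpposite.op (a i)
      map_add' := fun _ _ => rfl
      map_smul' := fun _ _ => rfl }
  exact ⟨n, p ∘ₗ e, hp.comp fun b => ⟨fun i => (b i).unop, rfl⟩⟩

/-- The evaluation map from a right module to its double dual. -/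
def evalDual (A N : Type) [Ring A] [AddCommGroup N] [Module Aᵐᵒᵖ N] :
    N →ₗ[Aᵐᵒᵖ] ((N →ₗ[Aᵐᵒᵖ] A) →ₗ[A] A) where
  toFun x := { toFun := fun f => f x, map_add' := fun _ _ => rfl, map_smul' := fun _ _ => rfl }
  map_add' x y := LinearMap.ext fun f => map_add f x y
  map_smul' a x := LinearMap.ext fun f => map_smul f a x

/-- If `A` has left injective dimension at most one, finitely presented torsionless right modules
are reflexive. -/
theorem InjDimLE1.evalDual_bijective {A N : Type} [Ring A] (hid : InjDimLE1 A)
    [IsNoetherianRing Aᵐᵒᵖ]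
    [AddCommGroup N] [Module Aᵐᵒᵖ N] [Module.Finite Aᵐᵒᵖ N] {m : ℕ}
    (j : N →ₗ[Aᵐᵒᵖ] (Fin m → A)) (hj : Injective j) : Bijective (evalDual A N) := by
  constructor
  · intro x y hxy
    refine hj (funext fun i => ?_)
    exact LinearMap.congr_fun hxy (LinearMap.proj i ∘ₗ j)
  · intro ψ
    obtain ⟨n, p, hp⟩ := exists_free_surjective A N
    have : Module.Finite Aᵐᵒᵖ (Fin n → A) := by
      have : Module.Finite Aᵐᵒᵖ A := Module.Finite.of_surjective
        (LinearMap.toSpanSingleton Aᵐᵒᵖ A 1) fun a => ⟨MulOpposite.op a, by simp⟩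
      infer_instance
    obtain ⟨l, q, hq⟩ := exists_free_surjective A (LinearMap.ker p)
    let f : (N →ₗ[Aᵐᵒᵖ] A) →ₗ[A] ((Fin n → A) →ₗ[Aᵐᵒᵖ] A) :=
      { toFun := fun u => u ∘ₗ p, map_add' := fun _ _ => rfl, map_smul' := fun _ _ => rfl }
    let g : ((Fin n → A) →ₗ[Aᵐᵒᵖ] A) →ₗ[A] (LinearMap.ker p →ₗ[Aᵐᵒᵖ] A) :=
      { toFun := fun u => u ∘ₗ (LinearMap.ker p).subtype, map_add' := fun _ _ => rfl,
        map_smul' := fun _ _ => rfl }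
    have hf : Injective f := fun u v huv => LinearMap.ext fun x => by
      obtain ⟨a, rfl⟩ := hp x
      exact LinearMap.congr_fun huv a
    have hfg : LinearMap.range f = LinearMap.ker g := by
      ext u
      constructor
      · rintro ⟨v, rfl⟩
        refine LinearMap.ext fun a => ?_
        show v (p a) = 0
        rw [LinearMap.mem_ker.1 a.2, map_zero]
      · intro hu
        have hu' : LinearMap.ker p ≤ LinearMap.ker u := fun a ha =>
          LinearMap.congr_fun (show g u = 0 from hu) ⟨a, ha⟩
        let e := p.quotKerEquivOfSurjective hp
        refine ⟨(LinearMap.ker p).liftQ u hu' ∘ₗ e.symm.toLinearMap, LinearMap.ext fun a => ?_⟩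
        have : e.symm (p a) = Submodule.Quotient.mk a := e.symm_apply_eq.2 rfl
        show (LinearMap.ker p).liftQ u hu' (e.symm (p a)) = u a
        rw [this]
        rfl
    obtain ⟨ψ', hψ'⟩ := hid.exists_extension (inSub_dual_of_surjective q hq) f g hf hfg ψ
    refine ⟨p fun i => ψ' (LinearMap.proj i), LinearMap.ext fun u => ?_⟩
    have h₁ : f u = ∑ i, f u (Pi.single i 1) • (LinearMap.proj i : (Fin n → A) →ₗ[Aᵐᵒᵖ] A) := by
      refine LinearMap.ext fun a => ?_
      have ha : a = ∑ i, MulOpposite.op (a i) • (Pi.single i 1 : Fin n → A) := by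
        ext j
        simp [Finset.sum_apply, Pi.single_apply]
      conv_lhs => rw [ha]
      simp
    have h₂ : f u (fun i => ψ' (LinearMap.proj i)) = ψ' (f u) := by
      conv_rhs => rw [h₁]
      conv_lhs => rw [h₁]
      simp
    rw [← hψ']
    exact h₂

namespace FDMod

section Cover

variable {k A : Type} [Field k] [Ring A] [Algebra k A]

/-- The canonical surjection from a free module. -/
def cover (X : FDMod k A) : A ⊗[k] X →ₗ[A] X :=
  TensorProduct.AlgebraTensorModule.lift
    { toFun := fun a => Algebra.lsmul k k X a
      map_add' := fun a b => map_add _ a b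
      map_smul' := fun a b => map_mul _ a b }

theorem cover_tmul (X : FDMod k A) (a : A) (x : X) : cover X (a ⊗ₜ x) = a • x := rfl

theorem cover_surjective (X : FDMod k A) : Surjective (cover X) := fun x =>
  ⟨1 ⊗ₜ x, by rw [cover_tmul, one_smul]⟩

theorem cover_baseChange {X Y : FDMod k A} (f : X →ₗ[A] Y) (t : A ⊗[k] X) :
    cover Y ((f.restrictScalars k).baseChange A t) = f (cover X t) := by
  induction t with
  | zero => simp
  | tmul a x => simp [cover_tmul]
  | add s t hs ht => simp only [map_add, hs, ht]

end Cover

variable {k A : Type} [Field k] [Ring A] [Algebra k A] [Module.Finite k A]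

/-- The right module of maps to the ring. -/
abbrev star (k : Type) {A : Type} [Field k] [Ring A] [Algebra k A] [Module.Finite k A] (X : Type)
    [AddCommGroup X] [Module k X] [Module A X] [IsScalarTower k A X] [Module.Finite k X] :
    FDMod k Aᵐᵒᵖ := of k Aᵐᵒᵖ (X →ₗ[A] A)

theorem additive_star (hid : InjDimLE1 A) {l : FDMod k Aᵐᵒᵖ → ℚ} (hl : l ∈ additive k Aᵐᵒᵖ)
    (X Y Z : FDMod k A) (hZ : InSub A Z) (f : X →ₗ[A] Y) (g : Y →ₗ[A] Z) (hf : Injective f)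
    (hg : Surjective g) (h : LinearMap.range f = LinearMap.ker g) :
    l (star k Y) = l (star k X) + l (star k Z) := by
  let f' : (Y →ₗ[A] A) →ₗ[Aᵐᵒᵖ] (X →ₗ[A] A) :=
    { toFun := fun u => u ∘ₗ f, map_add' := fun _ _ => rfl, map_smul' := fun _ _ => rfl }
  let g' : (Z →ₗ[A] A) →ₗ[Aᵐᵒᵖ] (Y →ₗ[A] A) :=
    { toFun := fun u => u ∘ₗ g, map_add' := fun _ _ => rfl, map_smul' := fun _ _ => rfl }
  rw [add_comm]
  refine hl (star k Z) (star k Y) (star k X) g' f' ?_ (hid.exists_extension hZ f g hf h) ?_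
  · intro u v huv
    refine LinearMap.ext fun z => ?_
    obtain ⟨y, rfl⟩ := hg z
    exact LinearMap.congr_fun huv y
  · ext u
    constructor
    · rintro ⟨v, rfl⟩
      refine LinearMap.ext fun x => ?_
      have : f x ∈ LinearMap.ker g := h ▸ LinearMap.mem_range_self f x
      show v (g (f x)) = 0
      rw [LinearMap.mem_ker.1 this, map_zero]
    · intro hu
      have hu' : LinearMap.ker g ≤ LinearMap.ker u := by
        rw [← h]
        rintro _ ⟨x, rfl⟩
        exact LinearMap.congr_fun (show f' u = 0 from hu) x
      let e := g.quotKerEquivOfSurjective hg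
      refine ⟨(LinearMap.ker g).liftQ u hu' ∘ₗ e.symm.toLinearMap, LinearMap.ext fun y => ?_⟩
      have : e.symm (g y) = Submodule.Quotient.mk y := e.symm_apply_eq.2 rfl
      show (LinearMap.ker g).liftQ u hu' (e.symm (g y)) = u y
      rw [this]
      rfl

section Syzygy

/-- The free module with canonical surjection `cover`. -/
abbrev free (X : FDMod k A) : FDMod k A := of k A (A ⊗[k] X)

/-- The kernel of the canonical surjection from a free module. -/
abbrev syzygy (X : FDMod k A) : FDMod k A := of k A (LinearMap.ker (cover X))

theorem inSub_free (X : FDMod k A) : InSub A (free X) :=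
  ⟨_, (Algebra.TensorProduct.basis A (Module.finBasis k X)).equivFun.toLinearMap,
    LinearEquiv.injective _⟩

theorem inSub_syzygy (X : FDMod k A) : InSub A (syzygy X) :=
  (inSub_free X).of_injective (LinearMap.ker (cover X)).subtype (Submodule.subtype_injective _)

/-- Transfer of additive functions on right modules through the derived `A`-dual. -/
def starAdditive (hid : InjDimLE1 A) : additive k Aᵐᵒᵖ →ₗ[ℚ] additive k A where
  toFun l := ⟨fun X => l.1 (star k (free X)) - l.1 (star k (syzygy X)),
    fun X Y Z f g hf hg h => by
      let F : free X →ₗ[A] free Y := (f.restrictScalars k).baseChange A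
      let G : free Y →ₗ[A] free Z := (g.restrictScalars k).baseChange A
      have hF : Injective F :=
        Module.Flat.lTensor_preserves_injective_linearMap (M := A) (f.restrictScalars k) hf
      have hG : Surjective G := LinearMap.lTensor_surjective A (g := g.restrictScalars k) hg
      have hFG : ∀ y, G y = 0 ↔ y ∈ Set.range F := lTensor_exact A
        (f := f.restrictScalars k) (g := g.restrictScalars k)
        (fun y => by
          have : y ∈ LinearMap.ker g ↔ y ∈ LinearMap.range f := by rw [h]
          exact this) hg
      have h₁ := additive_star hid l.2 (free X) (free Y) (free Z) (inSub_free Z) F G hF hG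
        (Submodule.ext fun y => (hFG y).symm)
      let F' : syzygy X →ₗ[A] syzygy Y := F.restrict
          (p := LinearMap.ker (cover X)) (q := LinearMap.ker (cover Y)) fun t ht => by
        rw [LinearMap.mem_ker] at ht ⊢
        exact (cover_baseChange f t).trans (by rw [ht, map_zero])
      let G' : syzygy Y →ₗ[A] syzygy Z := G.restrict
          (p := LinearMap.ker (cover Y)) (q := LinearMap.ker (cover Z)) fun t ht => by
        rw [LinearMap.mem_ker] at ht ⊢
        exact (cover_baseChange g t).trans (by rw [ht, map_zero])
      have h₂ := additive_star hid l.2 (syzygy X) (syzygy Y) (syzygy Z) (inSub_syzygy Z) F' G'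
        (fun a b hab => Subtype.ext (hF (congr_arg Subtype.val hab)))
        (by
          rintro ⟨z, hz⟩
          obtain ⟨y, rfl⟩ := hG z
          have hy : cover Y y ∈ LinearMap.ker g :=
            (cover_baseChange g y).symm.trans hz
          rw [← h] at hy
          obtain ⟨x, hx⟩ := hy
          obtain ⟨t, rfl⟩ := cover_surjective X x
          refine ⟨⟨y - F t, ?_⟩, Subtype.ext ?_⟩
          · rw [LinearMap.mem_ker, map_sub, ← hx, sub_eq_zero]
            exact (cover_baseChange f t).symm
          · show G (y - F t) = G y
            rw [map_sub, (hFG _).2 ⟨t, rfl⟩, sub_zero])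
        (by
          ext y
          constructor
          · rintro ⟨x, rfl⟩
            exact Subtype.ext ((hFG _).2 ⟨x, rfl⟩)
          · intro hy
            obtain ⟨x, hx⟩ := (hFG _).1 (congr_arg Subtype.val (show G' y = 0 from hy))
            refine ⟨⟨x, ?_⟩, Subtype.ext hx⟩
            refine hf ((cover_baseChange f x).symm.trans ?_)
            rw [map_zero]
            exact (congr_arg (cover Y) hx).trans y.2)
      simp only [h₁, h₂]; ring⟩
  map_add' a b := by
    ext X
    show (a.1 _ + b.1 _) - (a.1 _ + b.1 _) = (a.1 _ - a.1 _) + (b.1 _ - b.1 _)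
    ring
  map_smul' c a := by
    ext X
    exact (mul_sub c (a.1 (star k (free X))) (a.1 (star k (syzygy X)))).symm

theorem starAdditive_apply (hid : InjDimLE1 A) (l : additive k Aᵐᵒᵖ) (W : FDMod k A)
    (hW : InSub A W) : (starAdditive hid l).1 W = l.1 (star k W) := by
  have := additive_star hid l.2 (syzygy W) (free W) W hW (LinearMap.ker (cover W)).subtype
    (cover W) (Submodule.subtype_injective _) (cover_surjective W) (Submodule.range_subtype _)
  show l.1 (star k (free W)) - l.1 (star k (syzygy W)) = _
  rw [this]; ring

theorem additive_eq_zero_of_torsionless (hid : InjDimLE1 A) {l : additive k Aᵐᵒᵖ}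
    (hl : starAdditive hid l = 0) (N : FDMod k Aᵐᵒᵖ) {m : ℕ} (j : N →ₗ[Aᵐᵒᵖ] (Fin m → A))
    (hj : Injective j) : l.1 N = 0 := by
  have : IsNoetherianRing Aᵐᵒᵖ := isNoetherian_of_tower k inferInstance
  have : Module.Finite Aᵐᵒᵖ N := Module.Finite.of_restrictScalars_finite k Aᵐᵒᵖ N
  obtain ⟨n, p, hp⟩ := exists_free_surjective A N
  let W : FDMod k A := of k A (N →ₗ[Aᵐᵒᵖ] A)
  have h := starAdditive_apply hid l W (inSub_dual_of_surjective p hp)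
  rw [hl] at h
  rw [additive_congr l.2 (X := N) (Y := star k W) (evalDual A N) (hid.evalDual_bijective j hj)]
  exact h.symm

theorem starAdditive_injective (hid : InjDimLE1 A) :
    Injective (starAdditive (k := k) hid) := by
  refine (injective_iff_map_eq_zero _).2 fun l hl => ?_
  ext N
  have : Module.Finite Aᵐᵒᵖ N := Module.Finite.of_restrictScalars_finite k Aᵐᵒᵖ N
  obtain ⟨n, p, hp⟩ := exists_free_surjective A N
  let P : FDMod k Aᵐᵒᵖ := of k Aᵐᵒᵖ (Fin n → A)
  have h := l.2 (of k Aᵐᵒᵖ (LinearMap.ker p)) P N (LinearMap.ker p).subtype p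
    (Submodule.subtype_injective _) hp (Submodule.range_subtype _)
  rw [additive_eq_zero_of_torsionless hid hl P LinearMap.id injective_id,
    additive_eq_zero_of_torsionless hid hl (of k Aᵐᵒᵖ (LinearMap.ker p))
      (LinearMap.ker p).subtype (Submodule.subtype_injective _), zero_add] at h
  exact h.symm

/-- The dimension of a torsionless module is determined by its `A`-dual. -/
theorem exists_additive_star_eq_finrank (hid : InjDimLE1 A) :
    ∃ l ∈ additive k Aᵐᵒᵖ, ∀ W : FDMod k A, InSub A W →
      l (star k W) = (Module.finrank k W : ℚ) := by
  let e : A ≃ₐ[k] Aᵐᵒᵖᵐᵒᵖ := AlgEquiv.opOp k A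
  let E := starAdditive (k := k) hid ∘ₗ dualAdditive e
  have hE : Injective E := (starAdditive_injective hid).comp (dualAdditive_injective e)
  obtain ⟨d, hd⟩ := LinearMap.injective_iff_surjective.1 hE
    ⟨fun X : FDMod k A => (Module.finrank k X : ℚ), finrank_mem_additive⟩
  refine ⟨(dualAdditive e d).1, (dualAdditive e d).2, fun W hW => ?_⟩
  rw [← starAdditive_apply hid _ W hW]
  exact congr_fun (congr_arg Subtype.val hd) W

/-- An injection of torsionless modules inducing an isomorphism on `A`-duals is surjective. -/
theorem surjective_of_bijective_star (hid : InjDimLE1 A) (X K : FDMod k A) (hK : InSub A K)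
    (f : X →ₗ[A] K) (hf : Injective f)
    (h : ∀ u : X →ₗ[A] A, ∃ v : K →ₗ[A] A, v ∘ₗ f = u)
    (h₀ : ∀ v : K →ₗ[A] A, v ∘ₗ f = 0 → v = 0) : Surjective f := by
  obtain ⟨l, hl, hdim⟩ := exists_additive_star_eq_finrank (k := k) hid
  let f' : star k K →ₗ[Aᵐᵒᵖ] star k X :=
    { toFun := fun u => u ∘ₗ f, map_add' := fun _ _ => rfl, map_smul' := fun _ _ => rfl }
  have h₁ := additive_congr hl f' ⟨(injective_iff_map_eq_zero f').2 h₀, h⟩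
  rw [hdim K hK, hdim X (hK.of_injective f hf)] at h₁
  exact (LinearMap.injective_iff_surjective_of_finrank_eq_finrank (f := f.restrictScalars k)
    (by exact_mod_cast h₁.symm)).1 hf

end Syzygy

end FDMod

section ClusterTilting

variable {A : Type} [Ring A] {M X Y Z : Type} [AddCommGroup M] [Module A M] [AddCommGroup X]
  [Module A X] [AddCommGroup Y] [Module A Y] [AddCommGroup Z] [Module A Z]

theorem InSub.ring : InSub A A :=
  ⟨1, LinearMap.pi fun _ => LinearMap.id, fun _ _ h => congr_fun h 0⟩

theorem InAdd.pi (M : Type) [AddCommGroup M] [Module A M] (n : ℕ) : InAdd A M (Fin n → M) :=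
  ⟨n, LinearMap.id, LinearMap.id, rfl⟩

theorem Ext1Zero.of_projective [Module.Projective A Z] : Ext1Zero A Z X :=
  fun _ _ _ _ g _ hg _ => Module.projective_lifting_property g LinearMap.id hg

/-- If every map `X → M` extends along `f`, then so does every map from `X` to an object of
`add M`. -/
theorem InAdd.exists_extension (hZ : InAdd A M Z) (f : X →ₗ[A] Y)
    (h : ∀ u : X →ₗ[A] M, ∃ v : Y →ₗ[A] M, v ∘ₗ f = u) (u : X →ₗ[A] Z) :
    ∃ v : Y →ₗ[A] Z, v ∘ₗ f = u := by
  obtain ⟨n, s, r, hrs⟩ := hZ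
  choose v hv using fun i => h (LinearMap.proj i ∘ₗ s ∘ₗ u)
  refine ⟨r ∘ₗ LinearMap.pi v, LinearMap.ext fun x => ?_⟩
  have h₁ : (fun i => v i (f x)) = s (u x) := funext fun i => LinearMap.congr_fun (hv i) x
  show r (fun i => v i (f x)) = u x
  rw [h₁]
  exact LinearMap.congr_fun hrs (u x)

/-- The cokernel of a left approximation is `Ext`-orthogonal. -/
theorem Ext1Zero.of_approximation (hY : Ext1Zero A Y M) (f : X →ₗ[A] Y) (g : Y →ₗ[A] Z)
    (hg : Surjective g) (h : LinearMap.range f = LinearMap.ker g)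
    (hf : ∀ u : X →ₗ[A] M, ∃ v : Y →ₗ[A] M, v ∘ₗ f = u) : Ext1Zero A Z M := by
  intro E _ _ i q hi hq hiq
  let P : Submodule A (E × Y) := LinearMap.eqLocus (q ∘ₗ LinearMap.fst A E Y)
    (g ∘ₗ LinearMap.snd A E Y)
  have hqi : ∀ m, q (i m) = 0 := fun m => by
    have : i m ∈ LinearMap.ker q := hiq ▸ LinearMap.mem_range_self i m
    exact this
  have hgf : ∀ x, g (f x) = 0 := fun x => by
    have : f x ∈ LinearMap.ker g := h ▸ LinearMap.mem_range_self f x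
    exact this
  let a : M →ₗ[A] P := (LinearMap.inl A E Y ∘ₗ i).codRestrict P fun m => by
    show q (i m) = g 0
    rw [hqi, map_zero]
  let b : P →ₗ[A] Y := LinearMap.snd A E Y ∘ₗ P.subtype
  obtain ⟨s, hs⟩ := hY P a b
    (fun m m' hm => hi (congr_arg (fun p : P => p.1.1) hm))
    (fun y => by
      obtain ⟨e, he⟩ := hq (g y)
      exact ⟨⟨(e, y), he⟩, rfl⟩)
    (by
      ext ⟨⟨e, y⟩, hey⟩
      constructor
      · rintro ⟨m, hm⟩
        exact (congr_arg (fun p : P => p.1.2) hm).symm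
      · intro hy
        have hy : y = 0 := hy
        have he : e ∈ LinearMap.ker q := by
          have : q e = g y := hey
          rw [LinearMap.mem_ker, this, hy, map_zero]
        rw [← hiq] at he
        obtain ⟨m, rfl⟩ := he
        exact ⟨m, Subtype.ext (Prod.ext rfl hy.symm)⟩)
  let σ : Y →ₗ[A] E := LinearMap.fst A E Y ∘ₗ P.subtype ∘ₗ s
  have hσ : ∀ y, q (σ y) = g y := fun y => by
    have h₁ : q (s y).1.1 = g (s y).1.2 := (s y).2
    have h₂ : (s y).1.2 = y := LinearMap.congr_fun hs y
    exact h₁.trans (by rw [h₂])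
  have hmem : ∀ x, (σ ∘ₗ f) x ∈ LinearMap.range i := fun x => by
    rw [hiq, LinearMap.mem_ker]
    exact (hσ _).trans (hgf x)
  let e := LinearEquiv.ofInjective i hi
  obtain ⟨v, hv⟩ := hf (e.symm.toLinearMap ∘ₗ (σ ∘ₗ f).codRestrict _ hmem)
  have hv' : ∀ x, i (v (f x)) = σ (f x) := fun x => by
    have h₁ : v (f x) = e.symm ⟨σ (f x), hmem x⟩ := LinearMap.congr_fun hv x
    rw [h₁]
    exact congr_arg Subtype.val (e.apply_symm_apply ⟨σ (f x), hmem x⟩)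
  have hker : LinearMap.ker g ≤ LinearMap.ker (σ - i ∘ₗ v) := by
    rw [← h]
    rintro _ ⟨x, rfl⟩
    simp [hv']
  let w := g.quotKerEquivOfSurjective hg
  refine ⟨(LinearMap.ker g).liftQ (σ - i ∘ₗ v) hker ∘ₗ w.symm.toLinearMap,
    LinearMap.ext fun z => ?_⟩
  obtain ⟨y, rfl⟩ := hg z
  have : w.symm (g y) = Submodule.Quotient.mk y := w.symm_apply_eq.2 rfl
  show q ((LinearMap.ker g).liftQ (σ - i ∘ₗ v) hker (w.symm (g y))) = g y
  rw [this]
  show q (σ y - i (v y)) = g y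
  rw [map_sub, hσ, hqi, sub_zero]

/-- `Hom(X, M)` is projective over `End M` for `X` in `add M`. -/
theorem InAdd.projective_hom (hX : InAdd A M X) :
    Module.Projective (Module.End A M) (X →ₗ[A] M) := by
  obtain ⟨n, s, r, hrs⟩ := hX
  let i : (X →ₗ[A] M) →ₗ[Module.End A M] (Fin n → Module.End A M) :=
    { toFun := fun u j => u ∘ₗ r ∘ₗ LinearMap.single A (fun _ => M) j
      map_add' := fun _ _ => rfl
      map_smul' := fun _ _ => rfl }
  let p : (Fin n → Module.End A M) →ₗ[Module.End A M] (X →ₗ[A] M) :=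
    { toFun := fun u => ∑ j, u j ∘ₗ LinearMap.proj j ∘ₗ s
      map_add' := fun u v => by
        simp [LinearMap.add_comp, Finset.sum_add_distrib]
      map_smul' := fun c u => by
        rw [RingHom.id_apply, Finset.smul_sum]
        rfl }
  refine Module.Projective.of_split i p (LinearMap.ext fun u => LinearMap.ext fun x => ?_)
  have h : r (s x) = x := LinearMap.congr_fun hrs x
  show (∑ j, (u ∘ₗ r ∘ₗ LinearMap.single A (fun _ => M) j) ∘ₗ LinearMap.proj j ∘ₗ s) x = u x
  simp only [LinearMap.sum_apply, LinearMap.comp_apply, LinearMap.proj_apply]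
  rw [← map_sum, ← map_sum]
  simp only [LinearMap.coe_single]
  rw [Finset.univ_sum_single, h]

/-- An `add M`-approximation sequence gives a projective resolution of `Hom(X, M)`. -/
theorem pdLE_one_hom (hY : InAdd A M Y) (hZ : InAdd A M Z) (f : X →ₗ[A] Y) (g : Y →ₗ[A] Z)
    (hg : Surjective g) (h : LinearMap.range f = LinearMap.ker g)
    (hf : ∀ u : X →ₗ[A] M, ∃ v : Y →ₗ[A] M, v ∘ₗ f = u) :
    pdLE (Module.End A M) 1 (ModuleCat.of (Module.End A M) (X →ₗ[A] M)) := by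
  let p : (Y →ₗ[A] M) →ₗ[Module.End A M] (X →ₗ[A] M) :=
    { toFun := fun u => u ∘ₗ f, map_add' := fun _ _ => rfl, map_smul' := fun _ _ => rfl }
  refine ⟨ModuleCat.of _ (Y →ₗ[A] M), p, hY.projective_hom, hf, ?_⟩
  have hgf : ∀ x, g (f x) = 0 := fun x => by
    have : f x ∈ LinearMap.ker g := h ▸ LinearMap.mem_range_self f x
    exact this
  let c : (Z →ₗ[A] M) →ₗ[Module.End A M] LinearMap.ker p :=
    { toFun := fun u => ⟨u ∘ₗ g, LinearMap.ext fun x => by simp [p, hgf]⟩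
      map_add' := fun _ _ => rfl
      map_smul' := fun _ _ => rfl }
  have hc : Bijective c := by
    constructor
    · intro u v huv
      refine LinearMap.ext fun z => ?_
      obtain ⟨y, rfl⟩ := hg z
      exact LinearMap.congr_fun (congr_arg Subtype.val huv) y
    · rintro ⟨u, hu⟩
      have hu' : LinearMap.ker g ≤ LinearMap.ker u := by
        rw [← h]
        rintro _ ⟨x, rfl⟩
        exact LinearMap.congr_fun (show p u = 0 from hu) x
      let e := g.quotKerEquivOfSurjective hg
      refine ⟨(LinearMap.ker g).liftQ u hu' ∘ₗ e.symm.toLinearMap,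
        Subtype.ext (LinearMap.ext fun y => ?_)⟩
      have : e.symm (g y) = Submodule.Quotient.mk y := e.symm_apply_eq.2 rfl
      show (LinearMap.ker g).liftQ u hu' (e.symm (g y)) = u y
      rw [this]
      rfl
  have := hZ.projective_hom
  exact Module.Projective.of_equiv (LinearEquiv.ofBijective c hc)

section Field

variable {k : Type} [Field k] [Algebra k A] [Module.Finite k A]

/-- If every map `X → A` extends along `f : X → Y` with `Y` torsionless, then the cokernel of `f`
is torsionless. -/
theorem InjDimLE1.exists_range_eq_ker (hid : InjDimLE1 A) [Module k X] [IsScalarTower k A X]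
    [Module.Finite k X] [Module k Y] [IsScalarTower k A Y] [Module.Finite k Y]
    (hY : InSub A Y) (f : X →ₗ[A] Y) (hf : Injective f)
    (h : ∀ u : X →ₗ[A] A, ∃ v : Y →ₗ[A] A, v ∘ₗ f = u) :
    ∃ (m : ℕ) (g : Y →ₗ[A] (Fin m → A)), LinearMap.range f = LinearMap.ker g := by
  let r : (Y →ₗ[A] A) →ₗ[k] (X →ₗ[A] A) :=
    { toFun := fun u => u ∘ₗ f, map_add' := fun _ _ => rfl, map_smul' := fun _ _ => rfl }
  obtain ⟨_, b, hb⟩ := Module.Finite.exists_fin (R := k) (M := LinearMap.ker r)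
  let g : Y →ₗ[A] (Fin _ → A) := LinearMap.pi fun i => (b i).1
  have hgf : ∀ x, f x ∈ LinearMap.ker g := fun x =>
    funext fun i => LinearMap.congr_fun (show r (b i).1 = 0 from (b i).2) x
  have hg : ∀ u : Y →ₗ[A] A, u ∘ₗ f = 0 → ∀ y, g y = 0 → u y = 0 := fun u hu y hy => by
    have hmem : ∀ w ∈ Submodule.span k (Set.range b), w.1 y = 0 := fun w hw => by
      induction hw using Submodule.span_induction with
      | mem w hw =>
        obtain ⟨i, rfl⟩ := hw
        exact congr_fun hy i
      | zero => rfl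
      | add v w _ _ hv hw => exact (congr_arg₂ (· + ·) hv hw).trans (add_zero 0)
      | smul c w _ hw => exact (congr_arg (c • ·) hw).trans (smul_zero c)
    exact hmem ⟨u, hu⟩ (hb ▸ Submodule.mem_top)
  refine ⟨_, g, le_antisymm (by rintro _ ⟨x, rfl⟩; exact hgf x) fun y hy => ?_⟩
  have key := FDMod.surjective_of_bijective_star hid (FDMod.of k A X)
    (FDMod.of k A (LinearMap.ker g)) (hY.of_injective _ (LinearMap.ker g).subtype_injective)
    (f.codRestrict _ hgf) (fun x x' hx => hf (congr_arg Subtype.val hx))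
    (fun u => by
      obtain ⟨v, hv⟩ := h u
      exact ⟨v ∘ₗ (LinearMap.ker g).subtype, hv⟩)
    (fun v hv => by
      obtain ⟨w, rfl⟩ := hid.exists_extension ⟨_, LinearMap.id, injective_id⟩
        (LinearMap.ker g).subtype g (LinearMap.ker g).subtype_injective
        (Submodule.range_subtype _) v
      exact LinearMap.ext fun y => hg w hv y.1 y.2)
  obtain ⟨x, hx⟩ := key ⟨y, hy⟩
  exact ⟨x, congr_arg Subtype.val hx⟩

theorem InSub.module_finite [Module k X] [IsScalarTower k A X] (hX : InSub A X) :
    Module.Finite k X := by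
  obtain ⟨n, f, hf⟩ := hX
  exact Module.Finite.of_injective (f.restrictScalars k) hf

end Field

end ClusterTilting

theorem clusterTilting_approx_and_pd_le_one
    (k : Type) [Field k] (A : Type) [Ring A] [Algebra k A] [FiniteDimensional k A]
    (hid : InjDimLE1 A)
    (M : Type) [AddCommGroup M] [Module A M] (hM : IsClusterTilting A M)
    (X : Type) [AddCommGroup X] [Module A X] (hX : InSub A X) :
    (∃ (M₀ M₁ : ModuleCat.{0} A), InAdd A M M₀ ∧ InAdd A M M₁ ∧
      ∃ (f : X →ₗ[A] M₀) (g : M₀ →ₗ[A] M₁), Function.Injective f ∧ Function.Surjective g ∧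
        LinearMap.range f = LinearMap.ker g) ∧
    pdLE (Module.End A M) 1 (ModuleCat.of (Module.End A M) (X →ₗ[A] M)) := by
  let : Module k M := Module.compHom M (algebraMap k A)
  let : Module k X := Module.compHom X (algebraMap k A)
  have : IsScalarTower k A M := ⟨fun c a m => by
    rw [Algebra.smul_def, mul_smul]; rfl⟩
  have : IsScalarTower k A X := ⟨fun c a m => by
    rw [Algebra.smul_def, mul_smul]; rfl⟩
  have : Module.Finite k M := hM.1.module_finite
  have : Module.Finite k X := hX.module_finite
  let b := Module.finBasis k (X →ₗ[A] M)
  let f : X →ₗ[A] (Fin (Module.finrank k (X →ₗ[A] M)) → M) := LinearMap.pi b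
  have hext : ∀ u : X →ₗ[A] M, ∃ v, v ∘ₗ f = u := fun u =>
    ⟨∑ i, b.repr u i • LinearMap.proj i, by
      refine LinearMap.ext fun x => ?_
      have h := LinearMap.congr_fun (b.sum_repr u) x
      rw [LinearMap.sum_apply] at h
      simpa [f] using h⟩
  have hA : InAdd A M A := (hM.2 A InSub.ring).2.1 Ext1Zero.of_projective
  have hextA := hA.exists_extension f hext
  have hf : Injective f := by
    obtain ⟨n, j, hj⟩ := hX
    refine (injective_iff_map_eq_zero f).2 fun x hx => hj (funext fun i => ?_)
    obtain ⟨v, hv⟩ := hextA (LinearMap.proj i ∘ₗ j)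
    have := LinearMap.congr_fun hv x
    simp only [LinearMap.comp_apply, hx, map_zero] at this
    simpa using this.symm
  have hM₀ : InSub A (Fin (Module.finrank k (X →ₗ[A] M)) → M) := hM.1.pi _
  obtain ⟨m, g, hfg⟩ := hid.exists_range_eq_ker (k := k) hM₀ f hf hextA
  have hfg' : LinearMap.range f = LinearMap.ker g.rangeRestrict := by
    rw [LinearMap.ker_rangeRestrict, hfg]
  have hM₁ : InAdd A M (LinearMap.range g) :=
    (hM.2 _ ⟨m, (LinearMap.range g).subtype, Submodule.subtype_injective _⟩).2.1
      (((hM.2 _ hM₀).2.2 (InAdd.pi M _)).of_approximation f g.rangeRestrict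
        g.surjective_rangeRestrict hfg' hext)
  exact ⟨⟨ModuleCat.of A _, ModuleCat.of A _, InAdd.pi M _, hM₁, f, g.rangeRestrict, hf,
    g.surjective_rangeRestrict, hfg'⟩,
    pdLE_one_hom (InAdd.pi M _) hM₁ f g.rangeRestrict g.surjective_rangeRestrict hfg' hext⟩
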